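/- A bipartite graph G on at least four vertices is balanced and DM-irreducible if and only if G has an odd proper ear decomposition, i.e., a sequence (P_0, P_1, ..., P_f) of edge-disjoint subgraphs whose edge sets partition E(G), where P_0 is a cycle of length at least 4, and each P_i for i ≥ 1 is a path of odd length between two distinct vertices of the union of the previous ears whose inner vertices are new. -/

import Mathlib

open Sum

/-- The simple graph on `α ⊕ β` determined by an edge set `E ⊆ α × β`. -/
def sg {α β : Type*} (E : Set (α × β)) : SimpleGraph (α ⊕ β) :=
  SimpleGraph.fromRel (fun u v => ∃ a b, u = inl a ∧ v = inr b ∧ (a, b) ∈ E)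

/-- An odd proper ear decomposition of a graph `G`: a cycle `P₀` of length at least 4,
followed by ears `P₁, …, P_f` (here indexed by `Fin f`), each an odd-length path whose
two (distinct) endpoints lie in the union of the previous ears and whose inner vertices
are new; the edge sets of the ears are pairwise disjoint and partition the edge set of `G`,
and every vertex of `G` lies on some ear. -/
structure OddProperEarDecomp {V : Type*} (G : SimpleGraph V) where
  f : ℕ
  v0 : V
  P0 : G.Walk v0 v0
  hP0cyc : P0.IsCycle
  hP0len : 4 ≤ P0.length
  src : Fin f → V
  tgt : Fin f → V
  ear : (i : Fin f) → G.Walk (src i) (tgt i)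
  hpath : ∀ i, (ear i).IsPath
  hodd : ∀ i, Odd (ear i).length
  hne : ∀ i, src i ≠ tgt i
  hsrc : ∀ i : Fin f, src i ∈ P0.support ∨ ∃ j : Fin f, j < i ∧ src i ∈ (ear j).support
  htgt : ∀ i : Fin f, tgt i ∈ P0.support ∨ ∃ j : Fin f, j < i ∧ tgt i ∈ (ear j).support
  hinner : ∀ i : Fin f, ∀ v ∈ (ear i).support, v ≠ src i → v ≠ tgt i →
    ¬ (v ∈ P0.support ∨ ∃ j : Fin f, j < i ∧ v ∈ (ear j).support)
  hcover : ∀ e ∈ G.edgeSet, e ∈ P0.edges ∨ ∃ i : Fin f, e ∈ (ear i).edges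
  hdisj0 : ∀ i : Fin f, ∀ e ∈ (ear i).edges, e ∉ P0.edges
  hdisj : ∀ i j : Fin f, i ≠ j → ∀ e ∈ (ear i).edges, e ∉ (ear j).edges
  hspan : ∀ v : V, v ∈ P0.support ∨ ∃ i : Fin f, v ∈ (ear i).support

/-- Arc relation of the auxiliary digraph. -/
def Step {α β : Type*} (E M : Set (α × β)) : (α ⊕ β) → (α ⊕ β) → Prop
  | inl a, inr b => (a, b) ∈ E
  | inr b, inl a => (a, b) ∈ M
  | _, _ => False

def StronglyConnected {V : Type*} (R : V → V → Prop) : Prop :=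
  ∀ u v : V, Relation.ReflTransGen R u v

def IsPerfectMatching {α β : Type*} (E M : Set (α × β)) : Prop :=
  M ⊆ E ∧ (∀ a : α, ∃! b : β, (a, b) ∈ M) ∧ (∀ b : β, ∃! a : α, (a, b) ∈ M)

def DMIrreducible {α β : Type*} (E : Set (α × β)) : Prop :=
  ∃ M, IsPerfectMatching E M ∧ StronglyConnected (Step E M)

section helpers

variable {α β : Type*}

theorem sg_adj_lr {E : Set (α × β)} {a : α} {b : β} :
    (sg E).Adj (inl a) (inr b) ↔ (a, b) ∈ E := by
  simp [sg, SimpleGraph.fromRel_adj]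

theorem sg_adj_rl {E : Set (α × β)} {a : α} {b : β} :
    (sg E).Adj (inr b) (inl a) ↔ (a, b) ∈ E := by
  simp [sg, SimpleGraph.fromRel_adj]

theorem sg_adj_side {E : Set (α × β)} {u v : α ⊕ β} (h : (sg E).Adj u v) :
    u.isLeft = !v.isLeft := by
  rcases u with a | b <;> rcases v with a' | b' <;> simp_all [sg, SimpleGraph.fromRel_adj]

theorem sg_parity {E : Set (α × β)} {u v : α ⊕ β} (p : (sg E).Walk u v) :
    Even p.length ↔ u.isLeft = v.isLeft := by
  induction p with
  | nil => simp
  | cons h p ih =>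
    have := sg_adj_side h
    rw [SimpleGraph.Walk.length_cons, Nat.even_add_one, ih, this]
    generalize Sum.isLeft _ = x
    generalize Sum.isLeft _ = y
    cases x <;> cases y <;> simp

theorem Step_adj {E M : Set (α × β)} (hM : M ⊆ E) {u v : α ⊕ β} (h : Step E M u v) :
    (sg E).Adj u v := by
  rcases u with a | b <;> rcases v with a' | b' <;> simp only [Step] at h
  · exact sg_adj_lr.2 h
  · exact sg_adj_rl.2 (hM h)

section walks
variable {V : Type*} {G : SimpleGraph V}

theorem exists_dart_fst {u v : V} (p : G.Walk u v) {w : V} (hw : w ∈ p.support) (hne : w ≠ v) :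
    ∃ d ∈ p.darts, d.fst = w := by
  induction p with
  | nil => simp at hw; exact absurd hw hne
  | cons h p ih =>
    rw [SimpleGraph.Walk.support_cons, List.mem_cons] at hw
    rcases hw with rfl | hw
    · exact ⟨_, List.mem_cons_self, rfl⟩
    · obtain ⟨d, hd, h⟩ := ih hw hne
      exact ⟨d, List.mem_cons_of_mem _ hd, h⟩

theorem exists_dart_snd {u v : V} (p : G.Walk u v) {w : V} (hw : w ∈ p.support) (hne : w ≠ u) :
    ∃ d ∈ p.darts, d.snd = w := by
  have : w ∈ p.support.tail := by
    rw [← SimpleGraph.Walk.cons_tail_support, List.mem_cons] at hw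
    exact hw.resolve_left hne
  rw [← SimpleGraph.Walk.map_snd_darts] at this
  simpa using this

theorem dart_snd_inj {u v : V} {p : G.Walk u v} (hp : p.IsPath) {d d' : G.Dart}
    (hd : d ∈ p.darts) (hd' : d' ∈ p.darts) (h : d.snd = d'.snd) : d = d' := by
  refine List.inj_on_of_nodup_map (f := fun d : G.Dart => d.snd) ?_ hd hd' h
  rw [SimpleGraph.Walk.map_snd_darts]
  exact hp.support_nodup.tail

theorem dart_fst_inj {u v : V} {p : G.Walk u v} (hp : p.IsPath) {d d' : G.Dart}
    (hd : d ∈ p.darts) (hd' : d' ∈ p.darts) (h : d.fst = d'.fst) : d = d' := by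
  refine List.inj_on_of_nodup_map (f := fun d : G.Dart => d.fst) ?_ hd hd' h
  rw [SimpleGraph.Walk.map_fst_darts]
  exact hp.support_nodup.sublist (List.dropLast_sublist _)

theorem dart_snd_ne {u v : V} {p : G.Walk u v} (hp : p.IsPath) {d : G.Dart}
    (hd : d ∈ p.darts) : d.snd ≠ u := by
  intro h
  have h1 : d.snd ∈ p.support.tail := by
    rw [← SimpleGraph.Walk.map_snd_darts]; exact List.mem_map_of_mem hd
  have := hp.support_nodup
  rw [← SimpleGraph.Walk.cons_tail_support, List.nodup_cons] at this
  exact this.1 (h ▸ h1)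

theorem dart_fst_ne {u v : V} {p : G.Walk u v} (hp : p.IsPath) {d : G.Dart}
    (hd : d ∈ p.darts) : d.fst ≠ v := by
  have : d.symm ∈ p.reverse.darts := by simp [SimpleGraph.Walk.darts_reverse, hd]
  exact dart_snd_ne hp.reverse this

theorem reach_of_darts {R : V → V → Prop} {u v : V} (p : G.Walk u v)
    (h : ∀ d ∈ p.darts, R d.fst d.snd) : Relation.ReflTransGen R u v := by
  induction p with
  | nil => exact .refl
  | cons hh p ih =>
    rw [SimpleGraph.Walk.darts_cons] at h
    exact .head (h _ List.mem_cons_self) (ih fun d hd => h d (List.mem_cons_of_mem _ hd))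

theorem crossing {R : V → V → Prop} {S : Set V} {u v : V} (h : Relation.ReflTransGen R u v)
    (hu : u ∈ S) (hv : v ∉ S) : ∃ x y, x ∈ S ∧ y ∉ S ∧ R x y := by
  induction h with
  | refl => exact absurd hu hv
  | @tail b c _ hbc ih =>
    by_cases hb : b ∈ S
    · exact ⟨_, _, hb, hv, hbc⟩
    · exact ih hb

/-- first-hit directed path -/
theorem first_hit {R : V → V → Prop} (hR : ∀ u v, R u v → G.Adj u v) {S : Set V} {u v : V}
    (h : Relation.ReflTransGen R u v) (hv : v ∈ S) :
    ∃ (c : V) (p : G.Walk u c), p.IsPath ∧ c ∈ S ∧ (∀ w ∈ p.support, w ∈ S → w = c) ∧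
      ∀ d ∈ p.darts, R d.fst d.snd := by
  classical
  induction h using Relation.ReflTransGen.head_induction_on with
  | refl => exact ⟨v, .nil, by simp, hv, by simp, by simp⟩
  | @head x y hxy _ ih =>
    by_cases hx : x ∈ S
    · exact ⟨x, .nil, by simp, hx, by simp, by simp⟩
    obtain ⟨c, p, hp, hc, hS, hd⟩ := ih
    by_cases hxp : x ∈ p.support
    · refine ⟨c, p.dropUntil x hxp, hp.dropUntil hxp, hc, ?_, ?_⟩
      · intro w hw; exact hS w (p.support_dropUntil_subset_support hxp hw)
      · intro d hd'; exact hd d (p.darts_dropUntil_subset_darts hxp hd')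
    · refine ⟨c, .cons (hR _ _ hxy) p, ?_, hc, ?_, ?_⟩
      · rw [SimpleGraph.Walk.cons_isPath_iff]; exact ⟨hp, hxp⟩
      · intro w hw hwS
        rw [SimpleGraph.Walk.support_cons, List.mem_cons] at hw
        rcases hw with rfl | hw
        · exact absurd hwS hx
        · exact hS w hw hwS
      · intro d hd'
        rw [SimpleGraph.Walk.darts_cons, List.mem_cons] at hd'
        rcases hd' with rfl | h'
        · exact hxy
        · exact hd d h'

/-- An ear on `S` disjoint from `F`. -/
def EarOK (S : Set V) (F : Set (Sym2 V)) {u v : V} (p : G.Walk u v) : Prop :=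
  p.IsPath ∧ Odd p.length ∧ u ≠ v ∧ u ∈ S ∧ v ∈ S ∧
    (∀ w ∈ p.support, w ≠ u → w ≠ v → w ∉ S) ∧ ∀ e ∈ p.edges, e ∉ F

def SS {v0 : V} (P0 : G.Walk v0 v0) (e : ℕ → Σ u v, G.Walk u v) (i : ℕ) : Set V :=
  {w | w ∈ P0.support ∨ ∃ j < i, w ∈ (e j).2.2.support}

def FF {v0 : V} (P0 : G.Walk v0 v0) (e : ℕ → Σ u v, G.Walk u v) (i : ℕ) : Set (Sym2 V) :=
  {w | w ∈ P0.edges ∨ ∃ j < i, w ∈ (e j).2.2.edges}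

def PD (G : SimpleGraph V) (S : Set V) (F : Set (Sym2 V)) : Prop :=
  ∃ (v0 : V) (P0 : G.Walk v0 v0) (f : ℕ) (e : ℕ → Σ u v, G.Walk u v),
    P0.IsCycle ∧ 4 ≤ P0.length ∧ (∀ i < f, EarOK (SS P0 e i) (FF P0 e i) (e i).2.2) ∧
    S = SS P0 e f ∧ F = FF P0 e f

theorem PD.base {v0 : V} (P0 : G.Walk v0 v0) (h : P0.IsCycle) (h4 : 4 ≤ P0.length) :
    PD G {w | w ∈ P0.support} {w | w ∈ P0.edges} :=
  ⟨v0, P0, 0, fun _ => ⟨v0, v0, .nil⟩, h, h4, by simp, by simp [SS], by simp [FF]⟩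

theorem PD.ear {S : Set V} {F : Set (Sym2 V)} (h : PD G S F) {u v : V} (p : G.Walk u v)
    (hp : EarOK S F p) : PD G (S ∪ {w | w ∈ p.support}) (F ∪ {w | w ∈ p.edges}) := by
  obtain ⟨v0, P0, f, e, hc, h4, he, rfl, rfl⟩ := h
  have key : ∀ j < f, Function.update e f ⟨u, v, p⟩ j = e j := fun j hj =>
    Function.update_of_ne hj.ne _ _
  have hS : ∀ i ≤ f, SS P0 (Function.update e f ⟨u, v, p⟩) i = SS P0 e i := by
    intro i hi; ext w
    simp only [SS, Set.mem_ofPred_eq]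
    refine or_congr Iff.rfl (exists_congr fun j => and_congr_right fun hj => ?_)
    rw [key j (by omega)]
  have hF : ∀ i ≤ f, FF P0 (Function.update e f ⟨u, v, p⟩) i = FF P0 e i := by
    intro i hi; ext w
    simp only [FF, Set.mem_ofPred_eq]
    refine or_congr Iff.rfl (exists_congr fun j => and_congr_right fun hj => ?_)
    rw [key j (by omega)]
  refine ⟨v0, P0, f + 1, Function.update e f ⟨u, v, p⟩, hc, h4, ?_, ?_, ?_⟩
  · intro i hi
    rw [hS i (by omega), hF i (by omega)]
    rcases Nat.lt_succ_iff_lt_or_eq.1 hi with hi | rfl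
    · rw [key i hi]; exact he i hi
    · rw [Function.update_self]; exact hp
  · rw [← hS f le_rfl]
    ext w
    simp only [SS, Set.mem_union, Set.mem_ofPred_eq, Nat.lt_succ_iff_lt_or_eq, or_and_right,
      exists_or, exists_eq_left, or_assoc]
    rw [Function.update_self]
  · rw [← hF f le_rfl]
    ext w
    simp only [FF, Set.mem_union, Set.mem_ofPred_eq, Nat.lt_succ_iff_lt_or_eq, or_and_right,
      exists_or, exists_eq_left, or_assoc]
    rw [Function.update_self]

theorem PD.decomp {S : Set V} {F : Set (Sym2 V)} (h : PD G S F) (hS : ∀ v, v ∈ S)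
    (hF : ∀ e ∈ G.edgeSet, e ∈ F) : Nonempty (OddProperEarDecomp G) := by
  obtain ⟨v0, P0, f, e, hc, h4, he, rfl, rfl⟩ := h
  have hs : ∀ (i : Fin f) w, w ∈ SS P0 e i ↔
      (w ∈ P0.support ∨ ∃ j : Fin f, j < i ∧ w ∈ (e j).2.2.support) := by
    intro i w
    refine or_congr Iff.rfl ⟨?_, ?_⟩
    · rintro ⟨j, hj, h⟩; exact ⟨⟨j, hj.trans i.2⟩, hj, h⟩
    · rintro ⟨j, hj, h⟩; exact ⟨j, hj, h⟩
  refine ⟨{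
    f := f, v0 := v0, P0 := P0, hP0cyc := hc, hP0len := h4
    src := fun i => (e i).1
    tgt := fun i => (e i).2.1
    ear := fun i => (e i).2.2
    hpath := fun i => (he i i.2).1
    hodd := fun i => (he i i.2).2.1
    hne := fun i => (he i i.2).2.2.1
    hsrc := fun i => (hs i _).1 (he i i.2).2.2.2.1
    htgt := fun i => (hs i _).1 (he i i.2).2.2.2.2.1
    hinner := fun i v hv h1 h2 => by
      rw [← hs]; exact (he i i.2).2.2.2.2.2.1 v hv h1 h2
    hcover := ?_
    hdisj0 := fun i e' h' h0 => (he i i.2).2.2.2.2.2.2 e' h' (Or.inl h0)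
    hdisj := ?_
    hspan := ?_ }⟩
  · intro e' h'
    rcases hF e' h' with h | ⟨j, hj, h⟩
    · exact Or.inl h
    · exact Or.inr ⟨⟨j, hj⟩, h⟩
  · intro i j hij e' h1 h2
    rcases lt_or_gt_of_ne hij with h | h
    · exact (he j j.2).2.2.2.2.2.2 e' h2 (Or.inr ⟨i, h, h1⟩)
    · exact (he i i.2).2.2.2.2.2.2 e' h1 (Or.inr ⟨j, h, h2⟩)
  · intro v
    rcases hS v with h | ⟨j, hj, h⟩
    · exact Or.inl h
    · exact Or.inr ⟨⟨j, hj⟩, h⟩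

end walks

/-- matched, strongly connected piece -/
def Good (E : Set (α × β)) (S : Set (α ⊕ β)) : Prop :=
  ∃ M ⊆ E, (∀ a b, (a, b) ∈ M → inl a ∈ S ∧ inr b ∈ S) ∧
    (∀ a, inl a ∈ S → ∃! b, (a, b) ∈ M) ∧ (∀ b, inr b ∈ S → ∃! a, (a, b) ∈ M) ∧
    ∀ u ∈ S, ∀ v ∈ S, Relation.ReflTransGen (Step E M) u v

theorem Step_mono {E M M' : Set (α × β)} (h : M ⊆ M') {u v : α ⊕ β} (hs : Step E M u v) :
    Step E M' u v := by
  rcases u with a | b <;> rcases v with a' | b' <;> simp only [Step] at hs ⊢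
  · exact hs
  · exact h hs

theorem Good.ear_aux {E : Set (α × β)} {S : Set (α ⊕ β)} (h : Good E S) {x : α} {y : β}
    (p : (sg E).Walk (inl x) (inr y)) (hp : p.IsPath) (hx : inl x ∈ S) (hy : inr y ∈ S)
    (hin : ∀ w ∈ p.support, w ≠ inl x → w ≠ inr y → w ∉ S) :
    Good E (S ∪ {w | w ∈ p.support}) := by
  classical
  obtain ⟨M, hME, hMS, hMa, hMb, hsc⟩ := h
  let N : Set (α × β) := {ab | ∃ d ∈ p.darts, d.fst = inr ab.2 ∧ d.snd = inl ab.1}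
  have hstep : ∀ d ∈ p.darts, Step E (M ∪ N) d.fst d.snd := by
    intro d hd
    have hadj := d.adj
    rcases h1 : d.fst with a | b <;> rcases h2 : d.snd with a' | b' <;> rw [h1, h2] at hadj
    · simpa using sg_adj_side hadj
    · exact sg_adj_lr.1 hadj
    · exact Or.inr ⟨d, hd, h1, h2⟩
    · simpa using sg_adj_side hadj
  have hNl : ∀ a b, (a, b) ∈ N → inl a ∉ S := by
    rintro a b ⟨d, hd, h1, h2⟩ 
    simp only at h1 h2
    refine hin _ (h2 ▸ p.dart_snd_mem_support_of_mem_darts hd) ?_ (by simp)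
    rw [← h2]; exact dart_snd_ne hp hd
  have hNr : ∀ a b, (a, b) ∈ N → inr b ∉ S := by
    rintro a b ⟨d, hd, h1, h2⟩ 
    simp only at h1 h2
    refine hin _ (h1 ▸ p.dart_fst_mem_support_of_mem_darts hd) (by simp) ?_
    rw [← h1]; exact dart_fst_ne hp hd
  have hmono : ∀ u v, Relation.ReflTransGen (Step E M) u v →
      Relation.ReflTransGen (Step E (M ∪ N)) u v :=
    fun u v h => Relation.ReflTransGen.mono
      (fun _ _ => Step_mono (E := E) (M := M) (M' := M ∪ N) Set.subset_union_left) u v h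
  refine ⟨M ∪ N, ?_, ?_, ?_, ?_, ?_⟩
  · rintro ⟨a, b⟩ (h | ⟨d, hd, h1, h2⟩)
    · exact hME h
    · have := d.adj
      rw [h1, h2] at this
      exact sg_adj_rl.1 this
  · rintro a b (h | ⟨d, hd, h1, h2⟩)
    · exact ⟨Or.inl (hMS a b h).1, Or.inl (hMS a b h).2⟩
    · simp only at h1 h2
      exact ⟨Or.inr (h2 ▸ p.dart_snd_mem_support_of_mem_darts hd),
        Or.inr (h1 ▸ p.dart_fst_mem_support_of_mem_darts hd)⟩
  · intro a ha
    by_cases haS : inl a ∈ S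
    · obtain ⟨b, hb, hu⟩ := hMa a haS
      refine ⟨b, Or.inl hb, ?_⟩
      rintro b' (h | h)
      · exact hu b' h
      · exact absurd haS (hNl a b' h)
    · have has : inl a ∈ p.support := ha.resolve_left haS
      obtain ⟨d, hd, h2⟩ := exists_dart_snd p has (by rintro h; rw [h] at haS; exact haS hx)
      have hadj := d.adj
      rcases h1 : d.fst with a' | b <;> rw [h1, h2] at hadj
      · simpa using sg_adj_side hadj
      · refine ⟨b, Or.inr ⟨d, hd, h1, h2⟩, ?_⟩
        rintro b' (h | ⟨d', hd', h1', h2'⟩)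
        · exact absurd (hMS _ _ h).1 haS
        · have : d = d' := dart_snd_inj hp hd hd' (h2.trans h2'.symm)
          subst this
          simpa using h1'.symm.trans h1
  · intro b hb
    by_cases hbS : inr b ∈ S
    · obtain ⟨a, ha, hu⟩ := hMb b hbS
      refine ⟨a, Or.inl ha, ?_⟩
      rintro a' (h | h)
      · exact hu a' h
      · exact absurd hbS (hNr a' b h)
    · have has : inr b ∈ p.support := hb.resolve_left hbS
      obtain ⟨d, hd, h1⟩ := exists_dart_fst p has (by rintro h; rw [h] at hbS; exact hbS hy)
      have hadj := d.adj
      rcases h2 : d.snd with a | b' <;> rw [h1, h2] at hadj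
      · refine ⟨a, Or.inr ⟨d, hd, h1, h2⟩, ?_⟩
        rintro a' (h | ⟨d', hd', h1', h2'⟩)
        · exact absurd (hMS _ _ h).2 hbS
        · have : d = d' := dart_fst_inj hp hd hd' (h1.trans h1'.symm)
          subst this
          simpa using h2'.symm.trans h2
      · simpa using sg_adj_side hadj
  · have hto : ∀ u ∈ S ∪ {w | w ∈ p.support},
        ∃ s ∈ S, Relation.ReflTransGen (Step E (M ∪ N)) u s := by
      rintro u (h | h)
      · exact ⟨u, h, .refl⟩
      · exact ⟨_, hy, reach_of_darts (p.dropUntil u h)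
          fun d hd => hstep d (p.darts_dropUntil_subset_darts h hd)⟩
    have hfrom : ∀ u ∈ S ∪ {w | w ∈ p.support},
        ∃ s ∈ S, Relation.ReflTransGen (Step E (M ∪ N)) s u := by
      rintro u (h | h)
      · exact ⟨u, h, .refl⟩
      · exact ⟨_, hx, reach_of_darts (p.takeUntil u h)
          fun d hd => hstep d (p.darts_takeUntil_subset_darts h hd)⟩
    intro u hu v hv
    obtain ⟨s, hs, h1⟩ := hto u hu
    obtain ⟨t, ht, h2⟩ := hfrom v hv
    exact h1.trans ((hmono _ _ (hsc s hs t ht)).trans h2)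

theorem Good.ear {E : Set (α × β)} {S : Set (α ⊕ β)} (h : Good E S) {u v : α ⊕ β}
    (p : (sg E).Walk u v) (hp : p.IsPath) (huv : Odd p.length) (hu : u ∈ S) (hv : v ∈ S)
    (hin : ∀ w ∈ p.support, w ≠ u → w ≠ v → w ∉ S) :
    Good E (S ∪ {w | w ∈ p.support}) := by
  have hpar := sg_parity p
  rw [← Nat.not_even_iff_odd] at huv
  rcases u with a | b <;> rcases v with a' | b'
  · simp [huv] at hpar
  · exact h.ear_aux p hp hu hv hin
  · have := h.ear_aux p.reverse hp.reverse hv hu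
      (fun w hw h1 h2 => hin w (by simpa using hw) h2 h1)
    simpa using this
  · simp [huv] at hpar

theorem Good.pair {E : Set (α × β)} {u v : α ⊕ β} (h : (sg E).Adj u v) : Good E {u, v} := by
  have main : ∀ a b, (a, b) ∈ E → Good E {inl a, inr b} := by
    intro a b hab
    have h1 : Relation.ReflTransGen (Step E {(a, b)}) (inl a) (inr b) := .single hab
    have h2 : Relation.ReflTransGen (Step E {(a, b)}) (inr b) (inl a) :=
      .single (by simp [Step])
    refine ⟨{(a, b)}, by simpa using hab, ?_, ?_, ?_, ?_⟩
    · simp +contextual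
    · intro a' h; simp at h; subst h; exact ⟨b, by simp, by simp⟩
    · intro a' h; simp at h; subst h; exact ⟨a, by simp, by simp⟩
    · rintro u (rfl | rfl) v (rfl | rfl)
      exacts [.refl, h1, h2, .refl]
  rcases u with a | b <;> rcases v with a' | b'
  · simpa using sg_adj_side h
  · exact main _ _ (sg_adj_lr.1 h)
  · rw [Set.pair_comm]; exact main _ _ (sg_adj_rl.1 h)
  · simpa using sg_adj_side h

theorem Good.cycle {E : Set (α × β)} {u : α ⊕ β} (P : (sg E).Walk u u) (hP : P.IsCycle) :
    Good E {w | w ∈ P.support} := by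
  cases P with
  | nil => simp at hP
  | @cons _ v _ h p =>
    rw [SimpleGraph.Walk.cons_isCycle_iff] at hP
    have hodd : Odd p.length := by
      rw [← Nat.not_even_iff_odd, sg_parity]
      have := sg_adj_side h
      rw [this]; cases v.isLeft <;> decide
    have := (Good.pair h).ear p hP.1 hodd (by simp) (by simp) (by simp +contextual)
    convert this using 1
    ext w
    simp only [SimpleGraph.Walk.support_cons, List.mem_cons, Set.mem_ofPred_eq, Set.mem_union,
      Set.mem_insert_iff, Set.mem_singleton_iff]
    have : v ∈ p.support := by simp
    constructor
    · tauto
    · rintro ((h | rfl) | h) <;> tauto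

theorem Good.of_decomp {E : Set (α × β)} (D : OddProperEarDecomp (sg E)) : Good E Set.univ := by
  have key : ∀ k ≤ D.f, Good E {w | w ∈ D.P0.support ∨
      ∃ j : Fin D.f, (j : ℕ) < k ∧ w ∈ (D.ear j).support} := by
    intro k
    induction k with
    | zero => intro _; simpa using Good.cycle D.P0 D.hP0cyc
    | succ k ih =>
      intro hk
      have := (ih (by omega)).ear (D.ear ⟨k, hk⟩) (D.hpath _) (D.hodd _) (D.hsrc _) (D.htgt _)
        (D.hinner _)
      convert this using 1
      ext w
      simp only [Set.mem_union, Set.mem_ofPred_eq, or_assoc]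
      refine or_congr Iff.rfl ⟨?_, ?_⟩
      · rintro ⟨j, hj, h⟩
        rcases Nat.lt_succ_iff_lt_or_eq.1 hj with h' | h'
        · exact Or.inl ⟨j, h', h⟩
        · right
          have : j = ⟨k, hk⟩ := Fin.ext h'
          exact this ▸ h
      · rintro (⟨j, hj, h⟩ | h)
        · exact ⟨j, by omega, h⟩
        · exact ⟨⟨k, hk⟩, by simp, h⟩
  convert key D.f le_rfl
  symm
  rw [Set.eq_univ_iff_forall]
  intro v
  rcases D.hspan v with h | ⟨i, h⟩
  · exact Or.inl h
  · exact Or.inr ⟨i, i.2, h⟩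

/-- `S` closed under the matching -/
def Clo (M : Set (α × β)) (S : Set (α ⊕ β)) : Prop :=
  ∀ a b, (a, b) ∈ M → (inl a ∈ S ↔ inr b ∈ S)

theorem ear_exists {E M : Set (α × β)} (hM : IsPerfectMatching E M)
    (hsc : StronglyConnected (Step E M)) {S : Set (α ⊕ β)} {F : Set (Sym2 (α ⊕ β))}
    (hS : Clo M S) (hF : ∀ e ∈ F, ∀ v ∈ e, v ∈ S) {a : α} {b : β} (ha : inl a ∈ S)
    (hab : (a, b) ∈ E) (hnF : s(inl a, inr b) ∉ F) :
    ∃ (c : β) (P : (sg E).Walk (inl a) (inr c)), EarOK S F P ∧ s(inl a, inr b) ∈ P.edges ∧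
      Clo M (S ∪ {w | w ∈ P.support}) := by
  obtain ⟨hME, hMa, hMb⟩ := hM
  obtain ⟨c, q, hq, hc, hqS, hd⟩ := first_hit (G := sg E) (fun u v h => Step_adj hME h)
    (hsc (inr b) (inl a)) ha
  rcases c with a' | c
  · exfalso
    obtain ⟨d, hdm, h2⟩ := exists_dart_snd q q.end_mem_support (by simp)
    have := hd d hdm
    rcases h1 : d.fst with x | y <;> rw [h1, h2] at this <;> simp only [Step] at this
    have hy : inr y ∈ S := (hS _ _ this).1 hc
    have := hqS (inr y) (h1 ▸ q.dart_fst_mem_support_of_mem_darts hdm) hy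
    simp at this
  have hane : inl a ∉ q.support := fun h => by simpa using hqS _ h ha
  refine ⟨c, .cons (sg_adj_lr.2 hab) q, ⟨?_, ?_, by simp, ha, hc, ?_, ?_⟩, by simp, ?_⟩
  · rw [SimpleGraph.Walk.cons_isPath_iff]; exact ⟨hq, hane⟩
  · rw [← Nat.not_even_iff_odd, sg_parity]; simp
  · intro w hw h1 h2 hwS
    rw [SimpleGraph.Walk.support_cons, List.mem_cons] at hw
    exact h2 (hqS w (hw.resolve_left h1) hwS)
  · intro e he heF
    rw [SimpleGraph.Walk.edges_cons, List.mem_cons] at he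
    rcases he with rfl | he
    · exact hnF heF
    · induction e with
      | _ x y =>
      have hx := hqS x (q.fst_mem_support_of_mem_edges he) (hF _ heF x (by simp))
      have hy := hqS y (q.snd_mem_support_of_mem_edges he) (hF _ heF y (by simp))
      exact (q.adj_of_mem_edges he).ne (hx.trans hy.symm)
  · intro x y hxy
    have hmem : ∀ w, w ∈ S ∪ {w | w ∈ (SimpleGraph.Walk.cons (sg_adj_lr.2 hab) q).support} ↔
        w ∈ S ∨ w ∈ q.support := by
      intro w
      simp only [SimpleGraph.Walk.support_cons, List.mem_cons, Set.mem_ofPred_eq, Set.mem_union]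
      constructor
      · rintro (h | rfl | h) <;> tauto
      · tauto
    rw [hmem, hmem]
    by_cases hxS : inl x ∈ S
    · have := (hS x y hxy).1 hxS
      tauto
    have hyS : inr y ∉ S := fun h => hxS ((hS x y hxy).2 h)
    simp only [hxS, hyS, false_or]
    constructor
    · intro h
      obtain ⟨d, hdm, h2⟩ := exists_dart_snd q h (by simp)
      have := hd d hdm
      rcases h1 : d.fst with x' | y' <;> rw [h1, h2] at this <;> simp only [Step] at this
      rw [(hMa x).unique hxy this, ← h1]
      exact q.dart_fst_mem_support_of_mem_darts hdm
    · intro h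
      obtain ⟨d, hdm, h1⟩ := exists_dart_fst q h (fun h => hyS (h ▸ hc))
      have := hd d hdm
      rcases h2 : d.snd with x' | y' <;> rw [h1, h2] at this <;> simp only [Step] at this
      rw [(hMb y).unique hxy this, ← h2]
      exact q.dart_snd_mem_support_of_mem_darts hdm

theorem cross_edge {E M : Set (α × β)} 
    (hsc : StronglyConnected (Step E M)) {S : Set (α ⊕ β)}
    (hS : Clo M S) (hne : S.Nonempty) (hu : ∃ v, v ∉ S) :
    ∃ a b, inl a ∈ S ∧ inr b ∉ S ∧ (a, b) ∈ E := by
  obtain ⟨u, hu'⟩ := hne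
  obtain ⟨v, hv⟩ := hu
  obtain ⟨x, y, hx, hy, h⟩ := crossing (hsc u v) hu' hv
  rcases x with a | b <;> rcases y with a' | b' <;> simp only [Step] at h
  · exact ⟨a, b', hx, hy, h⟩
  · exact absurd ((hS _ _ h).2 hx) hy

def EarInv (E M : Set (α × β)) (S : Set (α ⊕ β)) (F : Set (Sym2 (α ⊕ β))) : Prop :=
  PD (sg E) S F ∧ Clo M S ∧ S.Nonempty ∧ ∀ e ∈ F, ∀ v ∈ e, v ∈ S

theorem mem_supp_of_edges {V : Type*} {G : SimpleGraph V} {u v : V} (p : G.Walk u v) {e : Sym2 V}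
    (he : e ∈ p.edges) {w : V} (hw : w ∈ e) : w ∈ p.support := by
  exact p.mem_support_of_mem_edges he hw

theorem EarInv.start [Fintype α] [Fintype β] {E M : Set (α × β)} (hM : IsPerfectMatching E M)
    (hsc : StronglyConnected (Step E M)) (hc : Fintype.card α = Fintype.card β)
    (hV : 4 ≤ Fintype.card α + Fintype.card β) : ∃ F S, EarInv E M S F := by
  classical
  have h1 : 1 < Fintype.card α := by omega
  obtain ⟨a, a', haa⟩ := Fintype.exists_pair_of_one_lt_card h1
  obtain ⟨b, hb, -⟩ := hM.2.1 a
  have hS : Clo M ({inl a, inr b} : Set (α ⊕ β)) := by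
    intro x y hxy
    simp only [Set.mem_insert_iff, Set.mem_singleton_iff, Sum.inl.injEq, Sum.inr.injEq,
      reduceCtorEq, or_false, false_or]
    constructor
    · rintro rfl; exact (hM.2.1 x).unique hxy hb
    · rintro rfl; exact (hM.2.2 y).unique hxy hb
  obtain ⟨x, y, hx, hy, hxy⟩ := cross_edge hsc hS ⟨inl a, by simp⟩ ⟨inl a', by simpa using haa.symm⟩
  obtain rfl : x = a := by simpa using hx
  have hyb : y ≠ b := by simpa using hy
  obtain ⟨c, P, hP, -, hcl⟩ := ear_exists hM hsc (F := {s(inl x, inr b)}) hS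
    (by simp) hx hxy (by simpa using hyb)
  obtain ⟨hp, hodd, -, -, hcS, -, hed⟩ := hP
  obtain rfl : c = b := by simpa using hcS
  have hcyc : (SimpleGraph.Walk.cons (sg_adj_rl.2 (hM.1 hb)) P).IsCycle := by
    rw [SimpleGraph.Walk.cons_isCycle_iff]
    refine ⟨hp, fun h => hed _ h ?_⟩
    rw [Sym2.eq_swap]; rfl
  have h4 : 4 ≤ (SimpleGraph.Walk.cons (sg_adj_rl.2 (hM.1 hb)) P).length := by
    have := hcyc.three_le_length
    rw [SimpleGraph.Walk.length_cons] at this ⊢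
    obtain ⟨k, hk⟩ := hodd
    omega
  refine ⟨_, _, PD.base _ hcyc h4, ?_, ⟨inl x, by simp⟩, fun e he v hv => mem_supp_of_edges _ he hv⟩
  convert hcl using 1
  ext w
  simp only [SimpleGraph.Walk.support_cons, List.mem_cons, Set.mem_ofPred_eq, Set.mem_union,
      Set.mem_insert_iff, Set.mem_singleton_iff]
  have : inl x ∈ P.support := by simp
  constructor
  · tauto
  · rintro ((rfl | h) | h) <;> tauto

theorem EarInv.step {E M : Set (α × β)} (hM : IsPerfectMatching E M)
    (hsc : StronglyConnected (Step E M)) {S F} (h : EarInv E M S F) {a : α} {b : β}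
    (ha : inl a ∈ S) (hab : (a, b) ∈ E) (hnF : s(inl a, inr b) ∉ F) :
    ∃ F' S', EarInv E M S' F' ∧ F ⊆ F' ∧ s(inl a, inr b) ∈ F' := by
  obtain ⟨h1, h2, h3, h4⟩ := h
  obtain ⟨c, P, hP, hmem, hcl⟩ := ear_exists hM hsc h2 h4 ha hab hnF
  refine ⟨_, _, ⟨h1.ear P hP, hcl, ⟨_, Or.inl ha⟩, ?_⟩, Set.subset_union_left, Or.inr hmem⟩
  rintro e (he | he) v hv
  · exact Or.inl (h4 e he v hv)
  · exact Or.inr (mem_supp_of_edges _ he hv)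

end helpers

theorem stmt13 {α β : Type*} [Fintype α] [Fintype β]
    (E : Set (α × β)) (hV : 4 ≤ Fintype.card α + Fintype.card β) :
    (Fintype.card α = Fintype.card β ∧ DMIrreducible E) ↔
      Nonempty (OddProperEarDecomp (sg E)) := by
  constructor
  · rintro ⟨hc, M, hM, hsc⟩
    have hne : ({F | ∃ S, EarInv E M S F} : Set (Set (Sym2 (α ⊕ β)))).Nonempty :=
      EarInv.start hM hsc hc hV
    obtain ⟨F, hF⟩ := (Set.toFinite _).exists_maximal hne
    obtain ⟨S, hI⟩ := hF.prop
    have hmax : ∀ a b, inl a ∈ S → (a, b) ∈ E → s(inl a, inr b) ∈ F := by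
      intro a b ha hab
      by_contra hn
      obtain ⟨F', S', h1, h2, h3⟩ := hI.step hM hsc ha hab hn
      exact hn (hF.le_of_ge ⟨S', h1⟩ h2 h3)
    have hS : ∀ v, v ∈ S := by
      by_contra hcon
      push Not at hcon
      obtain ⟨a, b, ha, hb, hab⟩ := cross_edge hsc hI.2.1 hI.2.2.1 hcon
      exact hb (hI.2.2.2 _ (hmax a b ha hab) _ (by simp))
    refine hI.1.decomp hS ?_
    intro e he
    induction e with
    | _ x y =>
    rw [SimpleGraph.mem_edgeSet] at he
    rcases x with a | b <;> rcases y with a' | b'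
    · simpa using sg_adj_side he
    · exact hmax _ _ (hS _) (sg_adj_lr.1 he)
    · rw [Sym2.eq_swap]; exact hmax _ _ (hS _) (sg_adj_rl.1 he)
    · simpa using sg_adj_side he
  · rintro ⟨D⟩
    obtain ⟨M, hME, -, hMa, hMb, hsc⟩ := Good.of_decomp D
    have hPM : IsPerfectMatching E M := ⟨hME, fun a => hMa a trivial, fun b => hMb b trivial⟩
    refine ⟨?_, M, hPM, fun u v => hsc u trivial v trivial⟩
    choose g hg hg' using hPM.2.1
    refine Fintype.card_of_bijective (f := g) ⟨?_, ?_⟩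
    · intro x y hxy
      exact (hPM.2.2 (g x)).unique (hg x) (by rw [hxy]; exact hg y)
    · intro b
      obtain ⟨a, ha, -⟩ := hPM.2.2 b
      exact ⟨a, (hg' a b ha).symm⟩
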